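/- Let x be a nonzero real number and p ∈ (0,1). Let X̂ be the MinMax estimator of x (law p·δ_{x/p} + (1−p)·δ_0) and X̃ the B-MinMax estimator of x (law p·δ_x + (1−p)·δ_0). Then the difference of mean squared errors satisfies E[(X̂ − x)²] − E[(X̃ − x)²] = x²·(1/p + p − 2) = x²·(p − 1)²/p. -/

import Mathlib

open MeasureTheory

/-- The mean squared error, as an estimator of `x`, of a random variable with law
`p·δ_a + (1−p)·δ_0`. -/
theorem integral_sub_sq_of_map_eq_two_point {Ω : Type*} [MeasurableSpace Ω] {μ : Measure Ω}
    {X : Ω → ℝ} (hX : Measurable X) {a p : ℝ} (x : ℝ) (hp0 : 0 ≤ p) (hp1 : p ≤ 1)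
    (hlaw : Measure.map X μ =
      ENNReal.ofReal p • Measure.dirac a + ENNReal.ofReal (1 - p) • Measure.dirac 0) :
    ∫ ω, (X ω - x) ^ 2 ∂μ = p * (a - x) ^ 2 + (1 - p) * x ^ 2 := by
  have hint (b : ℝ) : Integrable (fun y : ℝ => (y - x) ^ 2) (Measure.dirac b) :=
    integrable_dirac (by simp)
  have hmap : ∫ y, (y - x) ^ 2 ∂(Measure.map X μ) = ∫ ω, (X ω - x) ^ 2 ∂μ :=
    integral_map hX.aemeasurable (by fun_prop)
  rw [← hmap, hlaw, integral_add_measure ((hint a).smul_measure ENNReal.ofReal_ne_top)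
    ((hint 0).smul_measure ENNReal.ofReal_ne_top)]
  simp [integral_smul_measure, ENNReal.toReal_ofReal hp0,
    ENNReal.toReal_ofReal (sub_nonneg.2 hp1)]

/-- For nonzero `x` and `p ∈ (0,1)`, the difference in MSE between the MinMax
estimator `X̂` (law `p·δ_{x/p} + (1−p)·δ_0`) and the B-MinMax estimator `X̃`
(law `p·δ_x + (1−p)·δ_0`) satisfies
`E[(X̂ − x)²] − E[(X̃ − x)²] = x²·(1/p + p − 2) = x²·(p − 1)²/p`. -/
theorem mse_difference {Ω : Type*} [MeasurableSpace Ω] (μ : Measure Ω)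
    [IsProbabilityMeasure μ] (x p : ℝ) (hx : x ≠ 0) (hp : p ∈ Set.Ioo (0 : ℝ) 1)
    (Xhat Xtilde : Ω → ℝ) (hXhat : Measurable Xhat) (hXtilde : Measurable Xtilde)
    (hlawhat : Measure.map Xhat μ =
      ENNReal.ofReal p • Measure.dirac (x / p) +
        ENNReal.ofReal (1 - p) • Measure.dirac 0)
    (hlawtilde : Measure.map Xtilde μ =
      ENNReal.ofReal p • Measure.dirac x +
        ENNReal.ofReal (1 - p) • Measure.dirac 0) :
    ((∫ ω, (Xhat ω - x) ^ 2 ∂μ) - ∫ ω, (Xtilde ω - x) ^ 2 ∂μ =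
        x ^ 2 * (1 / p + p - 2)) ∧
      x ^ 2 * (1 / p + p - 2) = x ^ 2 * (p - 1) ^ 2 / p := by
  have hp0 : p ≠ 0 := hp.1.ne'
  rw [integral_sub_sq_of_map_eq_two_point hXhat x hp.1.le hp.2.le hlawhat,
    integral_sub_sq_of_map_eq_two_point hXtilde x hp.1.le hp.2.le hlawtilde]
  constructor <;> field_simp <;> ring
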